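/- Let β ∈ 𝔽_{q^m} with β ≠ 0 and λ ∈ 𝔽_q with λ ≠ 0, and set N₂ = Σ_{a,b ∈ 𝔽_{q^m}} Σ_{x ∈ 𝔽_q\{0}} Σ_{y ∈ 𝔽_q\{0}} Σ_{z ∈ 𝔽_q\{0}} ζ_q^{x·Tr(a²)} · ζ_q^{y·Tr(b²)} · ζ_q^{z·Tr(βa) − zλ} ∈ ℂ. Then: N₂ = −(q−1)²·G² if m is even and Tr(β²) = 0; N₂ = (q−1)·G² if m is even and Tr(β²) ≠ 0; and N₂ = 0 if m is odd. -/

import Mathlib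

open Finset

/-- The additive character `s ↦ exp(2πi·s̃/q)` of `ZMod q`. -/
noncomputable def zetaQ (q : ℕ) (s : ZMod q) : ℂ :=
  Complex.exp (2 * Real.pi * Complex.I * (s.val : ℂ) / (q : ℂ))

/-- The quadratic Gauss sum `G` over the big field `F`. -/
noncomputable def gaussBig (q : ℕ) [Fact q.Prime] (F : Type*) [Field F] [Fintype F]
    [DecidableEq F] [Algebra (ZMod q) F] : ℂ :=
  ∑ x ∈ Finset.univ.filter (fun x : F => x ≠ 0),
    (quadraticChar F x : ℂ) * zetaQ q (Algebra.trace (ZMod q) F x)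

/-- The quadratic Gauss sum `Ḡ` over the prime field `ZMod q`. -/
noncomputable def gaussSmall (q : ℕ) [Fact q.Prime] : ℂ :=
  ∑ y ∈ Finset.univ.filter (fun y : ZMod q => y ≠ 0),
    (quadraticChar (ZMod q) y : ℂ) * zetaQ q y

/-- The character sum `N₂` of Lemma 3.3. -/
noncomputable def Ntwo (q : ℕ) [Fact q.Prime] (F : Type*) [Field F] [Fintype F]
    [DecidableEq F] [Algebra (ZMod q) F] (β : F) (lam : ZMod q) : ℂ :=
  ∑ a : F, ∑ b : F, ∑ x ∈ Finset.univ.filter (fun x : ZMod q => x ≠ 0),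
    ∑ y ∈ Finset.univ.filter (fun y : ZMod q => y ≠ 0),
      ∑ z ∈ Finset.univ.filter (fun z : ZMod q => z ≠ 0),
        zetaQ q (x * Algebra.trace (ZMod q) F (a ^ 2)) *
          zetaQ q (y * Algebra.trace (ZMod q) F (b ^ 2)) *
          zetaQ q (z * Algebra.trace (ZMod q) F (β * a) - z * lam)

theorem zetaQ_eq_stdAddChar (q : ℕ) [Fact q.Prime] (s : ZMod q) :
    zetaQ q s = ZMod.stdAddChar s := by
  have h := ZMod.stdAddChar_coe (N := q) (s.val : ℤ)
  simpa [zetaQ] using h.symm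

/-- The additive character `x ↦ exp(2πi·Tr(x)/q)` of an extension of `ZMod q`. -/
noncomputable def traceAddChar (q : ℕ) [Fact q.Prime] (F : Type*) [Field F]
    [Algebra (ZMod q) F] : AddChar F ℂ :=
  (ZMod.stdAddChar (N := q)).compAddMonoidHom (Algebra.trace (ZMod q) F).toAddMonoidHom

theorem traceAddChar_apply (q : ℕ) [Fact q.Prime] (F : Type*) [Field F]
    [Algebra (ZMod q) F] (x : F) :
    traceAddChar q F x = ZMod.stdAddChar (Algebra.trace (ZMod q) F x) := rfl

theorem traceAddChar_isPrimitive (q : ℕ) [Fact q.Prime] (F : Type*) [Field F] [Fintype F]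
    [Algebra (ZMod q) F] : (traceAddChar q F).IsPrimitive := by
  apply AddChar.IsPrimitive.of_ne_one
  intro h
  obtain ⟨x, hx⟩ := Algebra.trace_surjective (ZMod q) F 1
  have h1 : traceAddChar q F x = 1 := by rw [h]; rfl
  rw [traceAddChar_apply, hx, ← AddChar.map_zero_eq_one (ZMod.stdAddChar (N := q))] at h1
  exact one_ne_zero (ZMod.injective_stdAddChar h1)

section QuadraticSums

variable {F : Type*} [Field F] [Fintype F] [DecidableEq F]

/-- Restriction of the quadratic character to a subfield of index `m`. -/
theorem quadraticChar_algebraMap {K : Type*} [Field K] [Fintype K] [DecidableEq K] [Algebra K F]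
    (hK : ringChar K ≠ 2) {m : ℕ} (hF : Fintype.card F = Fintype.card K ^ m) (y : K)
    (hy : y ≠ 0) : quadraticChar F (algebraMap K F y) = quadraticChar K y ^ m := by
  have hF2 : ringChar F ≠ 2 := by rwa [← Algebra.ringChar_eq K F]
  have hy' : algebraMap K F y ≠ 0 := by simpa using hy
  obtain ⟨k, hk⟩ : Odd (Fintype.card K) :=
    Nat.odd_iff.mpr (FiniteField.odd_card_of_char_ne_two hK)
  have hgeom : 2 * k * ∑ i ∈ Finset.range m, Fintype.card K ^ i + 1 = Fintype.card F := by
    rw [hF, hk]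
    have := geom_sum_mul_add (2 * k) m
    rw [← this]; ring
  have hs : (∑ i ∈ Finset.range m, Fintype.card K ^ i) % 2 = m % 2 := by
    rw [Finset.sum_nat_mod]
    have h1 (i : ℕ) : Fintype.card K ^ i % 2 = 1 :=
      Nat.odd_iff.mp (Odd.pow ⟨k, hk⟩)
    simp [h1]
  set s := ∑ i ∈ Finset.range m, Fintype.card K ^ i
  have hpow : ((quadraticChar F (algebraMap K F y) : ℤ) : F) =
      ((quadraticChar K y ^ m : ℤ) : F) := by
    rw [quadraticChar_eq_pow_of_char_ne_two' hF2]
    have hd : Fintype.card F / 2 = k * s := by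
      rw [← hgeom, mul_assoc]; omega
    have hyk : y ^ k = ((quadraticChar K y : ℤ) : K) := by
      rw [quadraticChar_eq_pow_of_char_ne_two' hK]
      congr 1; omega
    rw [hd, pow_mul, ← map_pow, hyk, map_intCast, ← Int.cast_pow]
    congr 1
    rcases quadraticChar_dichotomy hy with h | h <;> rw [h]
    · simp
    · rw [neg_one_pow_eq_pow_mod_two, hs, ← neg_one_pow_eq_pow_mod_two]
  have hne : (1 : F) ≠ -1 := (Ring.neg_one_ne_one_of_char_ne_two hF2).symm
  have hm' : quadraticChar K y ^ m = 1 ∨ quadraticChar K y ^ m = -1 := by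
    rcases quadraticChar_dichotomy hy with h | h <;> rw [h]
    · simp
    · exact neg_one_pow_eq_or ℤ m
  rcases quadraticChar_dichotomy hy' with h | h <;> rcases hm' with h' | h' <;>
    rw [h, h'] at hpow ⊢
  · simp [hne] at hpow
  · simp [hne.symm] at hpow

theorem sum_addChar_mul_sq (hF : ringChar F ≠ 2) {ψ : AddChar F ℂ} (hψ : ψ.IsPrimitive) {c : F}
    (hc : c ≠ 0) :
    ∑ b : F, ψ (c * b ^ 2) =
      quadraticChar F c * gaussSum ((quadraticChar F).ringHomComp (Int.castRingHom ℂ)) ψ := by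
  have hfiber : ∑ b : F, ψ (c * b ^ 2) =
      ∑ t : F, ((quadraticChar F t : ℂ) + 1) * ψ (c * t) := by
    rw [← Finset.sum_fiberwise Finset.univ (fun b : F => b ^ 2)]
    refine Finset.sum_congr rfl fun t _ => ?_
    have hcard := quadraticChar_card_sqrts hF t
    have hcard' : (#{b : F | b ^ 2 = t} : ℂ) = (quadraticChar F t : ℂ) + 1 := by
      have hset : {x : F | x ^ 2 = t}.toFinset = ({b : F | b ^ 2 = t} : Finset F) := by
        ext; simp
      rw [hset] at hcard
      exact_mod_cast hcard
    rw [← hcard', ← nsmul_eq_mul, ← Finset.sum_const]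
    refine Finset.sum_congr rfl fun b hb => ?_
    rw [(Finset.mem_filter.mp hb).2]
  have hzero : ∑ t : F, ψ (c * t) = 0 := by
    simpa using AddChar.sum_eq_zero_of_ne_one (hψ hc)
  have hshift := gaussSum_mulShift ((quadraticChar F).ringHomComp (Int.castRingHom ℂ)) ψ
    (Units.mk0 c hc)
  have hsq : (quadraticChar F c : ℂ) * quadraticChar F c = 1 := by
    have := quadraticChar_sq_one hc
    rw [← sq]; exact_mod_cast this
  simp only [Units.val_mk0, MulChar.ringHomComp_apply, eq_intCast] at hshift
  rw [hfiber, ← hshift, ← mul_assoc, hsq, one_mul]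
  simp [add_mul, Finset.sum_add_distrib, hzero, gaussSum]

theorem sum_addChar_quadratic (hF : ringChar F ≠ 2) {ψ : AddChar F ℂ} (hψ : ψ.IsPrimitive)
    {c : F} (hc : c ≠ 0) (d : F) :
    ∑ a : F, ψ (c * a ^ 2 + d * a) = ψ (-(d ^ 2 / (4 * c))) * (quadraticChar F c *
      gaussSum ((quadraticChar F).ringHomComp (Int.castRingHom ℂ)) ψ) := by
  have h2 : (2 : F) ≠ 0 := Ring.two_ne_zero hF
  have h4 : (4 : F) ≠ 0 := by
    rw [show (4 : F) = 2 * 2 by norm_num]; exact mul_ne_zero h2 h2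
  rw [← sum_addChar_mul_sq hF hψ hc, Finset.mul_sum,
    ← Equiv.sum_comp (Equiv.addRight (d / (2 * c))) (fun b => ψ _ * ψ (c * b ^ 2))]
  refine Finset.sum_congr rfl fun a _ => ?_
  rw [← AddChar.map_add_eq_mul]
  congr 1
  simp only [Equiv.coe_addRight]
  field_simp
  ring

theorem sum_ne_zero_addChar_mul {ψ : AddChar F ℂ} (hψ : ψ.IsPrimitive) {c : F} (hc : c ≠ 0) :
    ∑ z ∈ Finset.univ.filter (fun z : F => z ≠ 0), ψ (c * z) = -1 := by
  have hzero : ∑ t : F, ψ (c * t) = 0 := by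
    simpa using AddChar.sum_eq_zero_of_ne_one (hψ hc)
  rw [Finset.filter_ne', ← Finset.add_sum_erase _ _ (Finset.mem_univ 0)] at *
  rw [mul_zero, AddChar.map_zero_eq_one] at hzero
  linear_combination hzero

theorem sum_ne_zero_addChar_div {ψ : AddChar F ℂ} (hψ : ψ.IsPrimitive) {c : F} (hc : c ≠ 0) :
    ∑ x ∈ Finset.univ.filter (fun x : F => x ≠ 0), ψ (c / x) = -1 := by
  rw [← sum_ne_zero_addChar_mul hψ hc]
  refine Finset.sum_nbij' (fun x => x⁻¹) (fun x => x⁻¹) ?_ ?_ ?_ ?_ ?_ <;>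
    simp [div_eq_mul_inv]

end QuadraticSums

theorem gaussBig_eq_gaussSum (q : ℕ) [Fact q.Prime] (F : Type*) [Field F] [Fintype F]
    [DecidableEq F] [Algebra (ZMod q) F] :
    gaussBig q F =
      gaussSum ((quadraticChar F).ringHomComp (Int.castRingHom ℂ)) (traceAddChar q F) := by
  rw [gaussBig, gaussSum, Finset.sum_filter_of_ne]
  · simp [traceAddChar_apply, zetaQ_eq_stdAddChar]
  · rintro x - hx rfl
    simp at hx

theorem Ntwo_eq_sum_mul (q : ℕ) [Fact q.Prime] (F : Type*) [Field F] [Fintype F]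
    [DecidableEq F] [Algebra (ZMod q) F] (β : F) (lam : ZMod q) :
    Ntwo q F β lam =
      (∑ z ∈ Finset.univ.filter (fun z : ZMod q => z ≠ 0),
        ∑ x ∈ Finset.univ.filter (fun x : ZMod q => x ≠ 0), ZMod.stdAddChar (-lam * z) *
          ∑ a : F, traceAddChar q F
            (algebraMap (ZMod q) F x * a ^ 2 + algebraMap (ZMod q) F z * β * a)) *
      ∑ y ∈ Finset.univ.filter (fun y : ZMod q => y ≠ 0),
        ∑ b : F, traceAddChar q F (algebraMap (ZMod q) F y * b ^ 2) := by
  have hterm (a b : F) (x y z : ZMod q) :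
      zetaQ q (x * Algebra.trace (ZMod q) F (a ^ 2)) *
          zetaQ q (y * Algebra.trace (ZMod q) F (b ^ 2)) *
          zetaQ q (z * Algebra.trace (ZMod q) F (β * a) - z * lam) =
        ZMod.stdAddChar (-lam * z) * traceAddChar q F
          (algebraMap (ZMod q) F x * a ^ 2 + algebraMap (ZMod q) F z * β * a) *
        traceAddChar q F (algebraMap (ZMod q) F y * b ^ 2) := by
    simp only [zetaQ_eq_stdAddChar, traceAddChar_apply, ← AddChar.map_add_eq_mul, map_add,
      ← Algebra.smul_def, smul_mul_assoc, map_smul, smul_eq_mul]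
    congr 1
    ring
  simp only [Ntwo, hterm, ← Finset.mul_sum, ← Finset.sum_mul]
  rw [Finset.sum_comm (s := Finset.univ.filter (fun y : ZMod q => y ≠ 0))]
  congr 1
  simp only [Finset.mul_sum]
  rw [Finset.sum_comm, Finset.sum_congr rfl fun x _ => Finset.sum_comm, Finset.sum_comm]

theorem stmt3 (q m : ℕ) [Fact q.Prime] (hq : Odd q) (hm : 2 ≤ m)
    (F : Type*) [Field F] [Fintype F] [DecidableEq F] [Algebra (ZMod q) F]
    (hF : Fintype.card F = q ^ m) (β : F) (hβ : β ≠ 0) (lam : ZMod q) (hlam : lam ≠ 0) :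
    (Even m → Algebra.trace (ZMod q) F (β ^ 2) = 0 →
      Ntwo q F β lam = -((q : ℂ) - 1) ^ 2 * (gaussBig q F) ^ 2) ∧
    (Even m → Algebra.trace (ZMod q) F (β ^ 2) ≠ 0 →
      Ntwo q F β lam = ((q : ℂ) - 1) * (gaussBig q F) ^ 2) ∧
    (Odd m → Ntwo q F β lam = 0) := by
  have hK : ringChar (ZMod q) ≠ 2 := by
    rw [ZMod.ringChar_zmod_n]
    rintro rfl
    exact absurd hq (by decide)
  have hF2 : ringChar F ≠ 2 := by rwa [← Algebra.ringChar_eq (ZMod q) F]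
  have hψ := traceAddChar_isPrimitive q F
  have hχ := ZMod.isPrimitive_stdAddChar q
  have hη (y : ZMod q) (hy : y ≠ 0) :
      quadraticChar F (algebraMap (ZMod q) F y) = quadraticChar (ZMod q) y ^ m :=
    quadraticChar_algebraMap hK (by rw [hF, ZMod.card]) y hy
  have hinj (y : ZMod q) (hy : y ≠ 0) : algebraMap (ZMod q) F y ≠ 0 := by simpa using hy
  have hb : ∑ y ∈ Finset.univ.filter (fun y : ZMod q => y ≠ 0),
      ∑ b : F, traceAddChar q F (algebraMap (ZMod q) F y * b ^ 2) =
      (∑ y ∈ Finset.univ.filter (fun y : ZMod q => y ≠ 0),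
        (quadraticChar (ZMod q) y : ℂ) ^ m) * gaussBig q F := by
    rw [Finset.sum_mul]
    refine Finset.sum_congr rfl fun y hy => ?_
    have hy := (Finset.mem_filter.mp hy).2
    rw [sum_addChar_mul_sq hF2 hψ (hinj y hy), hη y hy, gaussBig_eq_gaussSum, Int.cast_pow]
  rw [Ntwo_eq_sum_mul, hb]
  have hcard : (#(Finset.univ.filter (fun y : ZMod q => y ≠ 0)) : ℂ) = (q : ℂ) - 1 := by
    rw [Finset.filter_ne', Finset.card_erase_of_mem (Finset.mem_univ _), Finset.card_univ,
      ZMod.card, Nat.cast_sub (Fact.out : q.Prime).one_le, Nat.cast_one]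
  have hsq (hme : Even m) (y : ZMod q) (hy : y ≠ 0) : quadraticChar (ZMod q) y ^ m = 1 := by
    obtain ⟨k, rfl⟩ := hme
    rw [← two_mul, pow_mul, quadraticChar_sq_one hy, one_pow]
  have hone (hme : Even m) : ∑ y ∈ Finset.univ.filter (fun y : ZMod q => y ≠ 0),
      (quadraticChar (ZMod q) y : ℂ) ^ m = (q : ℂ) - 1 := by
    rw [← hcard, ← nsmul_one, ← Finset.sum_const]
    refine Finset.sum_congr rfl fun y hy => ?_
    exact_mod_cast hsq hme y (Finset.mem_filter.mp hy).2
  have ha (hme : Even m) (z x : ZMod q) (hx : x ≠ 0) :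
      ∑ a : F, traceAddChar q F
        (algebraMap (ZMod q) F x * a ^ 2 + algebraMap (ZMod q) F z * β * a) =
      ZMod.stdAddChar (-(z ^ 2 / 4 * Algebra.trace (ZMod q) F (β ^ 2)) / x) * gaussBig q F := by
    rw [sum_addChar_quadratic hF2 hψ (hinj x hx), hη x hx, hsq hme x hx, gaussBig_eq_gaussSum,
      Int.cast_one, one_mul, traceAddChar_apply]
    congr 2
    have harg : -((algebraMap (ZMod q) F z * β) ^ 2 / (4 * algebraMap (ZMod q) F x)) =
        (-(z ^ 2 / (4 * x))) • β ^ 2 := by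
      rw [Algebra.smul_def]
      simp only [map_neg, map_div₀, map_mul, map_pow, map_ofNat]
      ring
    rw [harg, map_smul, smul_eq_mul]
    ring
  have hlam' := sum_ne_zero_addChar_mul hχ (neg_ne_zero.mpr hlam)
  refine ⟨fun hme hT => ?_, fun hme hT => ?_, fun hmo => ?_⟩
  · have hA : ∑ z ∈ Finset.univ.filter (fun z : ZMod q => z ≠ 0),
        ∑ x ∈ Finset.univ.filter (fun x : ZMod q => x ≠ 0), ZMod.stdAddChar (-lam * z) *
          ∑ a : F, traceAddChar q F
            (algebraMap (ZMod q) F x * a ^ 2 + algebraMap (ZMod q) F z * β * a) =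
        ∑ z ∈ Finset.univ.filter (fun z : ZMod q => z ≠ 0),
          ZMod.stdAddChar (-lam * z) * (((q : ℂ) - 1) * gaussBig q F) := by
      refine Finset.sum_congr rfl fun z _ => ?_
      rw [← Finset.mul_sum, ← hcard, ← nsmul_eq_mul, ← Finset.sum_const]
      congr 1
      refine Finset.sum_congr rfl fun x hx => ?_
      rw [ha hme z x (Finset.mem_filter.mp hx).2, hT]
      simp
    rw [hA, ← Finset.sum_mul, hlam', hone hme]
    ring
  · have h4 : (4 : ZMod q) ≠ 0 := by
      have h2 : (2 : ZMod q) ≠ 0 := Ring.two_ne_zero hK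
      rw [show (4 : ZMod q) = 2 * 2 by norm_num]; exact mul_ne_zero h2 h2
    have hA : ∑ z ∈ Finset.univ.filter (fun z : ZMod q => z ≠ 0),
        ∑ x ∈ Finset.univ.filter (fun x : ZMod q => x ≠ 0), ZMod.stdAddChar (-lam * z) *
          ∑ a : F, traceAddChar q F
            (algebraMap (ZMod q) F x * a ^ 2 + algebraMap (ZMod q) F z * β * a) =
        ∑ z ∈ Finset.univ.filter (fun z : ZMod q => z ≠ 0),
          ZMod.stdAddChar (-lam * z) * (-1 * gaussBig q F) := by
      refine Finset.sum_congr rfl fun z hz => ?_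
      have hz := (Finset.mem_filter.mp hz).2
      have hc : -(z ^ 2 / 4 * Algebra.trace (ZMod q) F (β ^ 2)) ≠ 0 :=
        neg_ne_zero.mpr (mul_ne_zero (div_ne_zero (pow_ne_zero 2 hz) h4) hT)
      rw [← Finset.mul_sum, ← sum_ne_zero_addChar_div hχ hc, Finset.sum_mul]
      congr 1
      exact Finset.sum_congr rfl fun x hx => ha hme z x (Finset.mem_filter.mp hx).2
    rw [hA, ← Finset.sum_mul, hlam', hone hme]
    ring
  · have hzero : ∑ y ∈ Finset.univ.filter (fun y : ZMod q => y ≠ 0),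
        (quadraticChar (ZMod q) y : ℂ) ^ m = 0 := by
      have hpow (y : ZMod q) (hy : y ≠ 0) :
          quadraticChar (ZMod q) y ^ m = quadraticChar (ZMod q) y := by
        obtain ⟨k, rfl⟩ := hmo
        rw [pow_succ, pow_mul, quadraticChar_sq_one hy, one_pow, one_mul]
      have hsum : ∑ y ∈ Finset.univ.filter (fun y : ZMod q => y ≠ 0),
          quadraticChar (ZMod q) y ^ m = 0 := by
        rw [← quadraticChar_sum_zero hK, Finset.sum_congr rfl fun y hy =>
          hpow y (Finset.mem_filter.mp hy).2, Finset.sum_filter_of_ne]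
        rintro y - hy rfl
        simp at hy
      exact_mod_cast hsum
    rw [hzero]
    ring
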